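/- arXiv:1102.0581 — 6 statements merged into one kernel-verified Lean document; each statement's English description precedes it below -/
import Mathlib

section
/- Let u, v, η, p_S, p_λ be real numbers with u > 0, v > 0 and 0 < η < 1; set κ = √(1 − η), c₀ = u/κ, m = u/v. Let ζ, s ∈ ℂ satisfy s² = ζ² + c₀² η. Define μ₁ = −κ(κζ + s)/(η u), μ₂ = −κ(κζ − s)/(η u), μ₃ = ζ/u. Let Φ₀ be the 5×5 complex matrix with rows: row 1 = (−(1−η)ζ/(ηu), −mζ/(ηu), −i m/(1−η), 0, 0); row 2 = (−(1−η)ζ/(η m u), −(1−η)ζ/(ηu), 0, 0, 0); row 3 = (i(1−η)/(η m), i/η, ζ/u, 0, 0); row 4 = ((1−η) p_S ζ/(η m² u), (1−η) p_S ζ/(η m u), i p_S/m, ζ/u, 0); row 5 = ((1−η) p_λ ζ/(η m² u), (1−η) p_λ ζ/(η m u), i p_λ/m, 0, ζ/u). Let T be the 5×5 complex matrix with columns: column 1 = (m s/(κ u), ζ/u, −i, −κ p_S s/(u m), −κ p_λ s/(u m)); column 2 = (−m s/(κ u), ζ/u, −i, κ p_S s/(u m), κ p_λ s/(u m)); column 3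 = (−i m/(1−η), i, ζ/u, 0, 0); column 4 = (0, 0, 0, 1, 0); column 5 = (0, 0, 0, 0, 1). Then Φ₀ · T = T · diag(μ₁, μ₂, μ₃, μ₃, μ₃); that is, for each i, the i-th column of T is an eigenvector of Φ₀ with eigenvalue μ_i (where μ₄ = μ₅ = μ₃). -/
open Complex

/-- The matrix `T` of formula (1.12) diagonalizes the leading coefficient matrix
`Φ₀` of the transposed linearized ZND system, with eigenvalues
`μ₁ = -κ(κζ+s)/(ηu)`, `μ₂ = -κ(κζ-s)/(ηu)`, `μ₃ = μ₄ = μ₅ = ζ/u`,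
where `s² = ζ² + c₀²η`, `κ = u/c₀ = √(1-η)`, `m = u/v`. -/
theorem Phi0_mul_T_eq_T_mul_diag
    (u v η pS pl : ℝ) (hu : 0 < u) (hv : 0 < v) (hη0 : 0 < η) (hη1 : η < 1)
    (κ c₀ m : ℝ)
    (hκ : κ = Real.sqrt (1 - η)) (hc₀ : c₀ = u / κ) (hm : m = u / v)
    (ζ s : ℂ) (hs : s ^ 2 = ζ ^ 2 + (c₀ : ℂ) ^ 2 * (η : ℂ))
    (μ₁ μ₂ μ₃ : ℂ)
    (hμ₁ : μ₁ = -(κ : ℂ) * ((κ : ℂ) * ζ + s) / ((η : ℂ) * (u : ℂ)))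
    (hμ₂ : μ₂ = -(κ : ℂ) * ((κ : ℂ) * ζ - s) / ((η : ℂ) * (u : ℂ)))
    (hμ₃ : μ₃ = ζ / (u : ℂ))
    (Φ₀ T : Matrix (Fin 5) (Fin 5) ℂ)
    (hΦ₀ : Φ₀ = !![
      -(1 - (η : ℂ)) * ζ / ((η : ℂ) * u), -(m : ℂ) * ζ / ((η : ℂ) * u),
        -I * m / (1 - (η : ℂ)), 0, 0;
      -(1 - (η : ℂ)) * ζ / ((η : ℂ) * m * u), -(1 - (η : ℂ)) * ζ / ((η : ℂ) * u),
        0, 0, 0;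
      I * (1 - (η : ℂ)) / ((η : ℂ) * m), I / (η : ℂ), ζ / (u : ℂ), 0, 0;
      (1 - (η : ℂ)) * pS * ζ / ((η : ℂ) * m ^ 2 * u),
        (1 - (η : ℂ)) * pS * ζ / ((η : ℂ) * m * u), I * pS / (m : ℂ),
        ζ / (u : ℂ), 0;
      (1 - (η : ℂ)) * pl * ζ / ((η : ℂ) * m ^ 2 * u),
        (1 - (η : ℂ)) * pl * ζ / ((η : ℂ) * m * u), I * pl / (m : ℂ),
        0, ζ / (u : ℂ)])
    (hT : T = !![
      (m : ℂ) * s / ((κ : ℂ) * u), -(m : ℂ) * s / ((κ : ℂ) * u),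
        -I * m / (1 - (η : ℂ)), 0, 0;
      ζ / (u : ℂ), ζ / (u : ℂ), I, 0, 0;
      -I, -I, ζ / (u : ℂ), 0, 0;
      -(κ : ℂ) * pS * s / ((u : ℂ) * m), (κ : ℂ) * pS * s / ((u : ℂ) * m),
        0, 1, 0;
      -(κ : ℂ) * pl * s / ((u : ℂ) * m), (κ : ℂ) * pl * s / ((u : ℂ) * m),
        0, 0, 1]) :
    Φ₀ * T = T * Matrix.diagonal ![μ₁, μ₂, μ₃, μ₃, μ₃] := by
  have hκ0 : 0 < κ := hκ ▸ Real.sqrt_pos.mpr (sub_pos.mpr hη1)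
  have hκη : (1 : ℂ) - η = (κ : ℂ) ^ 2 := by
    rw [hκ]
    exact_mod_cast (Real.sq_sqrt (sub_pos.mpr hη1).le).symm
  have hm0 : (m : ℂ) ≠ 0 := by
    rw [hm]
    exact_mod_cast (div_pos hu hv).ne'
  have hu' : (u : ℂ) ≠ 0 := by exact_mod_cast hu.ne'
  have hη' : (η : ℂ) ≠ 0 := by exact_mod_cast hη0.ne'
  have hκ' : (κ : ℂ) ≠ 0 := by exact_mod_cast hκ0.ne'
  have hs' : s ^ 2 * (κ : ℂ) ^ 2 = ζ ^ 2 * (κ : ℂ) ^ 2 + (u : ℂ) ^ 2 * η := by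
    rw [hs, hc₀]
    push_cast
    field_simp
  rw [hκη] at hΦ₀ hT
  have hI : I ^ 2 = -1 := I_sq
  generalize (κ : ℂ) = k at *
  generalize (η : ℂ) = e at *
  generalize (m : ℂ) = n at *
  generalize (u : ℂ) = w at *
  generalize I = j at *
  subst hΦ₀ hT hμ₁ hμ₂ hμ₃
  clear hκ hc₀ hm hκ0 hu hv hη0 hη1 hs
  ext a b
  rw [Matrix.mul_diagonal]
  fin_cases a <;> fin_cases b <;>
    simp [Matrix.mul_apply, Fin.sum_univ_five] <;> field_simp <;> grind
end

section
/- Let u, v, η, p_S, p_λ be real numbers with u > 0, v > 0 and 0 < η < 1; set κ = √(1 − η), m = u/v. Let ζ, s ∈ ℂ. Let T be the 5×5 complex matrix with columns: column 1 = (m s/(κ u), ζ/u, −i, −κ p_S s/(u m), −κ p_λ s/(u m)); column 2 = (−m s/(κ u), ζ/u, −i, κ p_S s/(u m), κ p_λ s/(u m)); column 3 = (−i m/(1−η), i, ζ/u, 0, 0); column 4 = (0, 0, 0, 1, 0); column 5 = (0, 0, 0, 0, 1). Then det T = (2 m s/(κ u³)) · (ζ² − u²). Consequently T is invertible if and only if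 s ≠ 0 and ζ² ≠ u². -/
open Complex

/-- A block lower triangular matrix with a `3 × 3` block followed by an identity block has the
determinant of the `3 × 3` block. -/
lemma det_fin_five_of_lower_block {R : Type*} [CommRing R]
    (a b c d e f g h k p q r x y z : R) :
    !![a, b, c, 0, 0; d, e, f, 0, 0; g, h, k, 0, 0; p, q, r, 1, 0; x, y, z, 0, 1].det =
      !![a, b, c; d, e, f; g, h, k].det := by
  simp [Matrix.det_succ_row_zero, Fin.sum_univ_succ, Fin.succAbove]

/-- The determinant of the eigenvector matrix `T` of formula (1.12) is
`det T = (2 m s/(κ u³))(ζ² - u²)`; hence `T` is invertible iff `s ≠ 0` and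
`ζ² ≠ u²` (the turning-point condition). -/
theorem det_T_eq
    (u v η pS pl : ℝ) (hu : 0 < u) (hv : 0 < v) (hη0 : 0 < η) (hη1 : η < 1)
    (κ m : ℝ) (hκ : κ = Real.sqrt (1 - η)) (hm : m = u / v)
    (ζ s : ℂ)
    (T : Matrix (Fin 5) (Fin 5) ℂ)
    (hT : T = !![
      (m : ℂ) * s / ((κ : ℂ) * u), -(m : ℂ) * s / ((κ : ℂ) * u),
        -I * m / (1 - (η : ℂ)), 0, 0;
      ζ / (u : ℂ), ζ / (u : ℂ), I, 0, 0;
      -I, -I, ζ / (u : ℂ), 0, 0;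
      -(κ : ℂ) * pS * s / ((u : ℂ) * m), (κ : ℂ) * pS * s / ((u : ℂ) * m),
        0, 1, 0;
      -(κ : ℂ) * pl * s / ((u : ℂ) * m), (κ : ℂ) * pl * s / ((u : ℂ) * m),
        0, 0, 1]) :
    T.det = 2 * (m : ℂ) * s / ((κ : ℂ) * (u : ℂ) ^ 3) * (ζ ^ 2 - (u : ℂ) ^ 2) ∧
    (IsUnit T ↔ (s ≠ 0 ∧ ζ ^ 2 ≠ (u : ℂ) ^ 2)) := by
  have hκ_pos : 0 < κ := hκ ▸ Real.sqrt_pos.2 (sub_pos.2 hη1)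
  have hm_pos : 0 < m := hm ▸ div_pos hu hv
  have hu0 : (u : ℂ) ≠ 0 := ofReal_ne_zero.2 hu.ne'
  have hκ0 : (κ : ℂ) ≠ 0 := ofReal_ne_zero.2 hκ_pos.ne'
  have hm0 : (m : ℂ) ≠ 0 := ofReal_ne_zero.2 hm_pos.ne'
  have hdet : T.det =
      2 * (m : ℂ) * s / ((κ : ℂ) * (u : ℂ) ^ 3) * (ζ ^ 2 - (u : ℂ) ^ 2) := by
    rw [hT, det_fin_five_of_lower_block, Matrix.det_fin_three]
    simp only [Matrix.of_apply, Matrix.cons_val]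
    field_simp
    linear_combination (2 * s * (u : ℂ) ^ 2) * I_sq
  refine ⟨hdet, ?_⟩
  rw [Matrix.isUnit_iff_isUnit_det, isUnit_iff_ne_zero, hdet]
  simp [hu0, hκ0, hm0, sub_eq_zero]
end

section
/- Let a > 0 be a real number and let ζ ∈ ℂ with Re ζ ≥ 0. Then Re((ζ² + a)^{1/2}) ≥ Re ζ, where (·)^{1/2} denotes the principal square root. -/
/-- Key estimate: for `a > 0` and `Re ζ ≥ 0`, the principal square root
satisfies `Re √(ζ² + a) ≥ Re ζ`. -/
theorem re_principal_sqrt_ge (a : ℝ) (ha : 0 < a) (ζ : ℂ) (hζ : 0 ≤ ζ.re) :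
    ζ.re ≤ ((ζ ^ 2 + (a : ℂ)) ^ ((1 : ℂ) / 2)).re := by
  rw [one_div, Complex.cpow_inv_two_re]
  apply Real.le_sqrt_of_sq_le
  have norm_ge : ‖ζ ^ 2‖ - a ≤ ‖ζ ^ 2 + (a : ℂ)‖ := by
    simpa only [Complex.norm_of_nonneg ha.le] using norm_sub_le_norm_add (ζ ^ 2) (a : ℂ)
  have norm_sq : ‖ζ ^ 2‖ = ζ.re ^ 2 + ζ.im ^ 2 := by
    rw [norm_pow, Complex.sq_norm, Complex.normSq_apply]
    ring
  have re_eq : (ζ ^ 2 + (a : ℂ)).re = ζ.re ^ 2 - ζ.im ^ 2 + a := by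
    simp [pow_two]
  linarith
end

section
/- Let κ, u, a be real numbers with 0 < κ < 1, u > 0, a > 0, and set η = 1 − κ². Let ζ ∈ ℂ with Re ζ > 0 and let s = (ζ² + a)^{1/2} be the principal square root. Define μ₁ = −κ(κζ + s)/(η u), μ₂ = −κ(κζ − s)/(η u), μ₃ = ζ/u. Then Re μ₁ < 0, Re μ₂ > 0, and Re μ₃ > 0. -/
/-- Adding a nonnegative real to `z` does not decrease the real part of its principal
square root. -/
theorem Complex.re_cpow_inv_two_le_add_ofReal (z : ℂ) {a : ℝ} (ha : 0 ≤ a) :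
    (z ^ (2⁻¹ : ℂ)).re ≤ ((z + (a : ℂ)) ^ (2⁻¹ : ℂ)).re := by
  rw [Complex.cpow_inv_two_re, Complex.cpow_inv_two_re]
  have h : ‖z‖ ≤ ‖z + (a : ℂ)‖ + a := by
    simpa [abs_of_nonneg ha] using norm_sub_le (z + (a : ℂ)) (a : ℂ)
  apply Real.sqrt_le_sqrt
  rw [Complex.add_re, Complex.ofReal_re]
  linarith

/-- For `Re ζ > 0`, among the eigenvalues `μ₁ = -κ(κζ+s)/(ηu)`,
`μ₂ = -κ(κζ-s)/(ηu)`, `μ₃ = ζ/u` (with `s = (ζ² + a)^{1/2}` the principal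
square root, `a = c₀²η > 0`, `η = 1 - κ²`), only `μ₁` has negative real part. -/
theorem only_mu1_decaying
    (κ u a : ℝ) (hκ0 : 0 < κ) (hκ1 : κ < 1) (hu : 0 < u) (ha : 0 < a)
    (η : ℝ) (hη : η = 1 - κ ^ 2)
    (ζ : ℂ) (hζ : 0 < ζ.re)
    (s μ₁ μ₂ μ₃ : ℂ)
    (hs : s = (ζ ^ 2 + (a : ℂ)) ^ ((1 : ℂ) / 2))
    (hμ₁ : μ₁ = -(κ : ℂ) * ((κ : ℂ) * ζ + s) / ((η : ℂ) * (u : ℂ)))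
    (hμ₂ : μ₂ = -(κ : ℂ) * ((κ : ℂ) * ζ - s) / ((η : ℂ) * (u : ℂ)))
    (hμ₃ : μ₃ = ζ / (u : ℂ)) :
    μ₁.re < 0 ∧ 0 < μ₂.re ∧ 0 < μ₃.re := by
  have hle : ζ.re ≤ s.re := by
    have h := Complex.re_cpow_inv_two_le_add_ofReal (ζ ^ 2) ha.le
    rwa [Complex.sq_cpow_two_inv hζ, ← one_div, ← hs] at h
  have hηu : 0 < η * u := mul_pos (by rw [hη]; nlinarith) hu
  have hκζ : κ * ζ.re < ζ.re := mul_lt_of_lt_one_left hζ hκ1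
  have hκζ_pos : 0 < κ * ζ.re := mul_pos hκ0 hζ
  rw [hμ₁, hμ₂, hμ₃, ← Complex.ofReal_mul, ← Complex.ofReal_neg]
  simp only [Complex.div_ofReal_re, Complex.re_ofReal_mul, Complex.add_re, Complex.sub_re]
  refine ⟨div_neg_of_neg_of_pos ?_ hηu, div_pos ?_ hηu, div_pos hζ hu⟩
  · exact mul_neg_of_neg_of_pos (neg_neg_of_pos hκ0) (by linarith)
  · exact mul_pos_of_neg_of_neg (neg_neg_of_pos hκ0) (by linarith)
end

section
/- Let L₁, L₂, β₁, β₂, β₃ be real numbers with L₁ > 0, L₂ ≠ 0, β₁ > 0, β₃ > 0, and suppose |L₂| e^{β₂} > L₁. Define f : ℝ × ℂ → ℂ by f(ε, ν) = L₁ + L₂ · exp(iπ/2 − i ε β₁ + β₂ − ν β₃). Let ν ∈ ℂ satisfy Re ν = (β₂ − log(L₁/|L₂|))/β₃ (so that Re ν > 0), and let n ∈ ℤ. If L₂ > 0, set ε = ((2n − 1/2)π − β₃ Im ν)/β₁; if L₂ < 0, set ε = ((2n + 1/2)π − β₃ Im ν)/β₁. Then f(ε, ν) = 0, and the complex derivative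 of ν ↦ f(ε, ν) at this ν equals β₃ L₁, which is nonzero; in particular ν is a simple zero of ν ↦ f(ε, ν). -/
open Complex

/-- Step 3 of the proof of the Instability Theorem 5.3(d): for periodically
distributed wavenumbers `ε`, the approximate stability function
`f(ε,ν) = L₁ + L₂ exp(iπ/2 - iεβ₁ + β₂ - νβ₃)` has a simple zero at the point
`ν` with `Re ν = (β₂ - log(L₁/|L₂|))/β₃ > 0`, with `∂_ν f = β₃ L₁ ≠ 0` there. -/
theorem approximate_stability_function_simple_zero
    (L₁ L₂ β₁ β₂ β₃ : ℝ) (hL₁ : 0 < L₁) (hL₂ : L₂ ≠ 0) (hβ₁ : 0 < β₁)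
    (hβ₃ : 0 < β₃) (hbig : L₁ < |L₂| * Real.exp β₂)
    (f : ℝ → ℂ → ℂ)
    (hf : ∀ (ε : ℝ) (ν : ℂ), f ε ν =
      (L₁ : ℂ) + (L₂ : ℂ) *
        Complex.exp (I * ((Real.pi : ℂ) / 2) - I * (ε : ℂ) * (β₁ : ℂ) +
          (β₂ : ℂ) - ν * (β₃ : ℂ)))
    (ν : ℂ) (hν : ν.re = (β₂ - Real.log (L₁ / |L₂|)) / β₃)
    (n : ℤ) (ε : ℝ)
    (hεpos : 0 < L₂ → ε = ((2 * (n : ℝ) - 1 / 2) * Real.pi - β₃ * ν.im) / β₁)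
    (hεneg : L₂ < 0 → ε = ((2 * (n : ℝ) + 1 / 2) * Real.pi - β₃ * ν.im) / β₁) :
    0 < ν.re ∧
    f ε ν = 0 ∧
    HasDerivAt (fun w => f ε w) ((β₃ : ℂ) * (L₁ : ℂ)) ν ∧
    (β₃ : ℂ) * (L₁ : ℂ) ≠ 0 := by
  have hL₂abs : 0 < |L₂| := abs_pos.mpr hL₂
  have hratio : 0 < L₁ / |L₂| := div_pos hL₁ hL₂abs
  have hre : ν.re * β₃ = β₂ - Real.log (L₁ / |L₂|) := by
    rw [hν, div_mul_cancel₀ _ hβ₃.ne']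
  have hexpLog : Complex.exp (Real.log (L₁ / |L₂|) : ℂ) = ((L₁ / |L₂| : ℝ) : ℂ) := by
    rw [← Complex.ofReal_exp, Real.exp_log hratio]
  have hzero : (L₂ : ℂ) * Complex.exp (I * ((Real.pi : ℂ) / 2) - I * (ε : ℂ) * (β₁ : ℂ) +
      (β₂ : ℂ) - ν * (β₃ : ℂ)) = -(L₁ : ℂ) := by
    rcases lt_or_gt_of_ne hL₂ with hneg | hpos
    · have hε : ε * β₁ = (2 * (n : ℝ) + 1 / 2) * Real.pi - β₃ * ν.im := by
        rw [hεneg hneg, div_mul_cancel₀ _ hβ₁.ne']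
      have harg : I * ((Real.pi : ℂ) / 2) - I * (ε : ℂ) * (β₁ : ℂ) + (β₂ : ℂ) - ν * (β₃ : ℂ) =
          (Real.log (L₁ / |L₂|) : ℂ) - n * (2 * Real.pi * I) := by
        apply Complex.ext <;> simp <;> linarith
      rw [harg, Complex.exp_periodic.sub_int_mul_eq, hexpLog, ← Complex.ofReal_mul,
        ← Complex.ofReal_neg, abs_of_neg hneg]
      congr 1
      field_simp
    · have hε : ε * β₁ = (2 * (n : ℝ) - 1 / 2) * Real.pi - β₃ * ν.im := by
        rw [hεpos hpos, div_mul_cancel₀ _ hβ₁.ne']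
      have harg : I * ((Real.pi : ℂ) / 2) - I * (ε : ℂ) * (β₁ : ℂ) + (β₂ : ℂ) - ν * (β₃ : ℂ) =
          (Real.log (L₁ / |L₂|) : ℂ) + Real.pi * I - n * (2 * Real.pi * I) := by
        apply Complex.ext <;> simp <;> linarith
      rw [harg, Complex.exp_periodic.sub_int_mul_eq, Complex.exp_add, Complex.exp_pi_mul_I,
        hexpLog, mul_neg_one, mul_neg, ← Complex.ofReal_mul, abs_of_pos hpos,
        mul_div_cancel₀ _ hL₂]
  refine ⟨?_, ?_, ?_, ?_⟩
  · rw [hν]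
    refine div_pos (sub_pos.mpr ?_) hβ₃
    rwa [Real.log_lt_iff_lt_exp hratio, div_lt_iff₀' hL₂abs]
  · rw [hf, hzero, add_neg_cancel]
  · simp only [hf]
    have hderiv := ((((hasDerivAt_id ν).mul_const (β₃ : ℂ)).const_sub
      (I * ((Real.pi : ℂ) / 2) - I * (ε : ℂ) * (β₁ : ℂ) + (β₂ : ℂ))).cexp.const_mul
        (L₂ : ℂ)).const_add (L₁ : ℂ)
    refine hderiv.congr_deriv ?_
    rw [id_eq, ← mul_assoc, hzero]
    ring
  · exact_mod_cast (mul_pos hβ₃ hL₁).ne'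
end

section
/- Let x₀ ∈ ℂ, r > 0, and let g be holomorphic on the open disc D(x₀, r) with g(x₀) = 0 and g′(x₀) = d where d is a positive real number. Let r′ ∈ (0, r] and φ be holomorphic and nonvanishing on D(x₀, r′) with φ(x₀) = √d and ((z − x₀)^{1/2} φ(z))² = g(z) on D(x₀, r′), where (·)^{1/2} is the principal square root. Define F(z) = ∫_{x₀}^{z} (τ − x₀)^{1/2} φ(τ) dτ (the integral along the straight segment from x₀ to z, which is well defined since the integrand extends continuously to x₀ with value 0). Then there exists a holomorphic function ψ on D(x₀, r′) with ψ(x₀) = (2/3)√d such that F(z) = (z − x₀)^{1/2} · (z − x₀) · ψ(z) for all z ∈ D(x₀, r′). -/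
open Metric Set MeasureTheory intervalIntegral in
/-- A weighted average over `t ∈ [0, 1]` of the dilations `z ↦ φ (c + t (z - c))` of a function
holomorphic on a disc centred at `c` is holomorphic on that disc. -/
theorem differentiableOn_integral_mul_comp_dilation {c : ℂ} {R : ℝ} {φ : ℂ → ℂ} {w : ℝ → ℂ}
    (hφ : DifferentiableOn ℂ φ (ball c R)) (hw : Continuous w) :
    DifferentiableOn ℂ (fun z => ∫ t in (0 : ℝ)..1, w t * φ (c + (t : ℂ) * (z - c)))
      (ball c R) := by
  intro z hz
  obtain ⟨ρ, hzρ, hρR⟩ := exists_between (mem_ball.1 hz)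
  have hsub : closedBall c ρ ⊆ ball c R := closedBall_subset_ball hρR
  have hmem : ∀ x ∈ ball c ρ, ∀ t ∈ Icc (0 : ℝ) 1, c + (t : ℂ) * (x - c) ∈ closedBall c ρ := by
    intro x hx t ht
    rw [mem_ball, dist_eq_norm] at hx
    rw [mem_closedBall, dist_eq_norm, add_sub_cancel_left, norm_mul, Complex.norm_real,
      Real.norm_of_nonneg ht.1]
    nlinarith [norm_nonneg (x - c), ht.2]
  have hcomp : ∀ f : ℂ → ℂ, ContinuousOn f (ball c R) → ∀ x ∈ ball c ρ,
      ContinuousOn (fun t : ℝ => f (c + (t : ℂ) * (x - c))) (Icc 0 1) := fun f hf x hx =>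
    hf.comp (by fun_prop) fun t ht => hsub (hmem x hx t ht)
  have hmeas : ∀ {f : ℝ → ℂ}, ContinuousOn f (Icc 0 1) →
      AEStronglyMeasurable f (volume.restrict (uIoc (0 : ℝ) 1)) := fun hf => by
    rw [uIoc_of_le zero_le_one]
    exact (hf.mono Ioc_subset_Icc_self).aestronglyMeasurable measurableSet_Ioc
  have hφ' : ContinuousOn (deriv φ) (ball c R) := (hφ.deriv isOpen_ball).continuousOn
  obtain ⟨C, hC⟩ := (isCompact_closedBall c ρ).exists_bound_of_continuousOn (hφ'.mono hsub)
  have hρ : ball c ρ ∈ nhds z := isOpen_ball.mem_nhds (mem_ball.2 hzρ)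
  refine (hasDerivAt_integral_of_dominated_loc_of_deriv_le (μ := volume) (a := 0) (b := 1)
    (F := fun x (t : ℝ) => w t * φ (c + (t : ℂ) * (x - c)))
    (F' := fun x (t : ℝ) => w t * (deriv φ (c + (t : ℂ) * (x - c)) * t))
    (bound := fun t => ‖w t‖ * C) (x₀ := z) hρ
    (Filter.mem_of_superset hρ fun x hx =>
      hmeas (hw.continuousOn.mul (hcomp φ hφ.continuousOn x hx)))
    (ContinuousOn.intervalIntegrable_of_Icc zero_le_one
      (hw.continuousOn.mul (hcomp φ hφ.continuousOn z hzρ)))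
    (hmeas (hw.continuousOn.mul
      ((hcomp _ hφ' z hzρ).mul Complex.continuous_ofReal.continuousOn)))
    (Filter.Eventually.of_forall fun t ht x hx => ?_)
    ((hw.norm.mul continuous_const).intervalIntegrable _ _)
    (Filter.Eventually.of_forall fun t ht x hx => ?_)).2.differentiableAt.differentiableWithinAt
  · rw [uIoc_of_le zero_le_one] at ht
    have hb := hC _ (hmem x hx t (Ioc_subset_Icc_self ht))
    rw [norm_mul, norm_mul, Complex.norm_real, Real.norm_of_nonneg ht.1.le]
    gcongr
    nlinarith [norm_nonneg (deriv φ (c + (t : ℂ) * (x - c))), ht.1, ht.2]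
  · rw [uIoc_of_le zero_le_one] at ht
    have hd : HasDerivAt φ _ (c + (t : ℂ) * (x - c)) := (hφ.differentiableAt
      (isOpen_ball.mem_nhds (hsub (hmem x hx t (Ioc_subset_Icc_self ht))))).hasDerivAt
    have hin : HasDerivAt (fun x => c + (t : ℂ) * (x - c)) (t : ℂ) x := by
      simpa using (((hasDerivAt_id x).sub_const c).const_mul (t : ℂ)).const_add c
    exact (hd.comp x hin).const_mul (w t)

/-- The principal square root is multiplicative when one factor is a nonnegative real. -/
theorem Complex.ofReal_mul_cpow_one_half {t : ℝ} (ht : 0 ≤ t) (w : ℂ) :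
    ((t : ℂ) * w) ^ ((1 : ℂ) / 2) = (Real.sqrt t : ℂ) * w ^ ((1 : ℂ) / 2) := by
  rcases ht.eq_or_lt with rfl | ht'
  · simp
  rcases eq_or_ne w 0 with rfl | hw
  · simp
  have ht0 : (t : ℂ) ≠ 0 := Complex.ofReal_ne_zero.2 ht'.ne'
  have hsqrt : (Real.sqrt t : ℂ) = (t : ℂ) ^ ((1 : ℂ) / 2) := by
    rw [Real.sqrt_eq_rpow, Complex.ofReal_cpow ht]
    norm_num
  rw [hsqrt, cpow_def_of_ne_zero (mul_ne_zero ht0 hw), log_ofReal_mul ht' hw, ofReal_log ht,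
    add_mul, exp_add, ← cpow_def_of_ne_zero ht0, ← cpow_def_of_ne_zero hw]

theorem integral_ofReal_sqrt_zero_one :
    ∫ t in (0 : ℝ)..1, (Real.sqrt t : ℂ) = 2 / 3 := by
  have h : ∫ t in (0 : ℝ)..1, Real.sqrt t = 2 / 3 := by
    simp_rw [Real.sqrt_eq_rpow]
    rw [integral_rpow (Or.inl (by norm_num))]
    norm_num
  rw [intervalIntegral.integral_ofReal, h]
  norm_num

/-- Expansion (3.16): the antiderivative
`F(z) = ∫_{x₀}^{z} (τ - x₀)^{1/2} φ(τ) dτ` (along the straight segment) of the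
square-root factor near a turning point of increasing type has the form
`F(z) = (z - x₀)^{1/2} (z - x₀) ψ(z)` with `ψ` holomorphic and
`ψ(x₀) = (2/3)√d`. -/
theorem antiderivative_three_halves_expansion
    (x₀ : ℂ) (r : ℝ) (hr : 0 < r) (g : ℂ → ℂ)
    (hg : DifferentiableOn ℂ g (Metric.ball x₀ r))
    (hg0 : g x₀ = 0) (d : ℝ) (hd : 0 < d) (hg' : deriv g x₀ = (d : ℂ))
    (r' : ℝ) (hr'0 : 0 < r') (hr'r : r' ≤ r) (φ : ℂ → ℂ)
    (hφ : DifferentiableOn ℂ φ (Metric.ball x₀ r'))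
    (hφ0 : φ x₀ = (Real.sqrt d : ℂ))
    (hφne : ∀ z ∈ Metric.ball x₀ r', φ z ≠ 0)
    (hφsq : ∀ z ∈ Metric.ball x₀ r',
      ((z - x₀) ^ ((1 : ℂ) / 2) * φ z) ^ 2 = g z)
    (F : ℂ → ℂ)
    (hF : ∀ z ∈ Metric.ball x₀ r', F z =
      ∫ t in (0 : ℝ)..1,
        (z - x₀) * (((t : ℂ) * (z - x₀)) ^ ((1 : ℂ) / 2) *
          φ (x₀ + (t : ℂ) * (z - x₀)))) :
    ∃ ψ : ℂ → ℂ,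
      DifferentiableOn ℂ ψ (Metric.ball x₀ r') ∧
      ψ x₀ = (2 / 3 : ℂ) * (Real.sqrt d : ℂ) ∧
      ∀ z ∈ Metric.ball x₀ r',
        F z = (z - x₀) ^ ((1 : ℂ) / 2) * (z - x₀) * ψ z := by
  refine ⟨fun z => ∫ t in (0 : ℝ)..1, (Real.sqrt t : ℂ) * φ (x₀ + (t : ℂ) * (z - x₀)),
    differentiableOn_integral_mul_comp_dilation hφ (by fun_prop), ?_, fun z hz => ?_⟩
  · simp only [sub_self, mul_zero, add_zero, hφ0]
    rw [intervalIntegral.integral_mul_const, integral_ofReal_sqrt_zero_one]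
  · rw [hF z hz, ← intervalIntegral.integral_const_mul]
    refine intervalIntegral.integral_congr fun t ht => ?_
    rw [Set.uIcc_of_le zero_le_one] at ht
    simp only [Complex.ofReal_mul_cpow_one_half ht.1]
    ring
end
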